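/- arXiv:1709.04041 — 3 statements merged into one kernel-verified Lean document; each statement's English description precedes it below -/
import Mathlib

section
/- Let A : ℝ² → 𝔨 be continuous with A(x,0) = 0 for all x, let η : ℝ² → 𝔨 be continuous, set η̄(x,y) := η(x,y) − η(x,0), and let ℓ(x) = (x, y(x)) for x ∈ [a,b] be a horizontal curve with y continuous. Let u : [a,b] → K solve u'(x) = −A(x,y(x)) u(x), u(a) = I; let g_η : ℝ → K solve g_η'(x) = −η(x,0) g_η(x), g_η(0) = I; let k : [a,b] → K solve k'(x) = −( u(x)⁻¹ η(x,y(x)) u(x) ) k(x), k(a) = I; and let v : [a,b] → K solve v'(x) = −B(x,y(x)) v(x), v(a) = I, where B(x,y) := g_η(x)⁻¹ ( A(x,y) + η̄(x,y) ) g_η(x). Then: (i) g_η(x)⁻¹ (A+η)(x,y) g_η(x) + g_η(x)⁻¹ g_η'(x) = B(x,y) for all (x,y), i.e. B dx is the gauge transform [(A+η)dx]^{g_η} and it lies in the complete axial gauge; and (ii) v(x) = g_η(x)⁻¹ u(x) k(x) g_η(a) for all x ∈ [a,b]. -/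
/-!
Statement 4 (Corollary 3.9 of the paper).

`A dx` a connection one-form in the complete axial gauge (`A(x,0) = 0`), `η` a continuous
perturbation, `η̄(x,y) = η(x,y) − η(x,0)`, `ℓ(x) = (x, y(x))` a horizontal curve; `u` the
parallel translation along `ℓ` for `A dx`, `g_η` the solution of `g' = −η(·,0)g`, `k` the
solution of `k' = −Ad_{u⁻¹}η(·,y(·)) k`, and `v` the parallel translation along `ℓ` for the
gauge transformed connection `B dx = [(A+η)dx]^{g_η}`.  Then
(i) `B(x,y) = Ad_{g_η(x)⁻¹}(A(x,y) + η̄(x,y))` and `B` is in the complete axial gauge, and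
(ii) `v(x) = g_η(x)⁻¹ u(x) k(x) g_η(a)`.
-/

open Matrix

attribute [local instance] Matrix.linftyOpNormedAddCommGroup Matrix.linftyOpNormedRing
  Matrix.linftyOpNormedAlgebra

noncomputable section

/-- `D × D` complex matrices. -/
abbrev Mat (D : ℕ) := Matrix (Fin D) (Fin D) ℂ

/-- The matrix of an element of a matrix subgroup `K` of `GL(D, ℂ)`. -/
def Kval {D : ℕ} (K : Subgroup (Mat D)ˣ) (k : K) : Mat D := ((k : (Mat D)ˣ) : Mat D)

theorem lin_ode_unique_aux {E : Type*} [NormedRing E] [NormedAlgebra ℝ E] (a b : ℝ)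
    (C z w : ℝ → E) (hC : ContinuousOn C (Set.Icc a b))
    (hz : ∀ x ∈ Set.Icc a b, HasDerivWithinAt z (-(C x) * z x) (Set.Icc a b) x)
    (hw : ∀ x ∈ Set.Icc a b, HasDerivWithinAt w (-(C x) * w x) (Set.Icc a b) x)
    (h0 : z a = w a) : Set.EqOn z w (Set.Icc a b) := by
  obtain ⟨M, hM⟩ := isCompact_Icc.exists_bound_of_continuousOn hC
  have key : ∀ f : ℝ → E,
      (∀ x ∈ Set.Icc a b, HasDerivWithinAt f (-(C x) * f x) (Set.Icc a b) x) →
      ∀ t ∈ Set.Ico a b, HasDerivWithinAt f (-(C t) * f t) (Set.Ici t) t := by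
    intro f hf t ht
    refine (hf t ⟨ht.1, ht.2.le⟩).mono_of_mem_nhdsWithin ?_
    exact Filter.mem_of_superset (Icc_mem_nhdsGE ht.2)
      (Set.Icc_subset_Icc_left ht.1)
  refine ODE_solution_unique_of_mem_Icc_right (v := fun t x => -(C t) * x)
    (s := fun _ => Set.univ) (K := M.toNNReal) ?_
    (fun x hx => (hz x hx).continuousWithinAt) (key z hz) (fun _ _ => Set.mem_univ _)
    (fun x hx => (hw x hx).continuousWithinAt) (key w hw) (fun _ _ => Set.mem_univ _) h0
  intro t ht
  refine (LipschitzWith.of_dist_le_mul ?_).lipschitzOnWith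
  intro p q
  rw [dist_eq_norm, dist_eq_norm, ← mul_sub]
  refine (norm_mul_le _ _).trans ?_
  rw [norm_neg]
  gcongr
  exact (hM t ⟨ht.1, ht.2.le⟩).trans (Real.le_coe_toNNReal M)

theorem Kval_inv_mul_aux {D : ℕ} (K : Subgroup (Mat D)ˣ) (k : K) :
    Kval K k⁻¹ * Kval K k = 1 := by simp [Kval]

theorem Kval_mul_inv_aux {D : ℕ} (K : Subgroup (Mat D)ˣ) (k : K) :
    Kval K k * Kval K k⁻¹ = 1 := by simp [Kval]

theorem Kval_one_aux {D : ℕ} (K : Subgroup (Mat D)ˣ) : Kval K 1 = 1 := by simp [Kval]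

theorem stmt4 {D : ℕ} (K : Subgroup (Mat D)ˣ)
    (A η : ℝ × ℝ → Mat D) (hA : Continuous A) (hη : Continuous η)
    (hA0 : ∀ x : ℝ, A (x, 0) = 0)
    (a b : ℝ) (hab : a ≤ b)
    (y : ℝ → ℝ) (hy : ContinuousOn y (Set.Icc a b))
    -- `u` : parallel translation along `ℓ(x) = (x, y(x))` with respect to `A dx`
    (u : ℝ → K) (hu0 : u a = 1)
    (hu : ∀ x ∈ Set.Icc a b, HasDerivWithinAt (fun x' => Kval K (u x'))
      (-(A (x, y x)) * Kval K (u x)) (Set.Icc a b) x)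
    -- `g = g_η` : the solution of `g'(x) = −η(x,0) g(x)`, `g(0) = I`
    (g : ℝ → K) (hg0 : g 0 = 1)
    (hg : ∀ x : ℝ, HasDerivAt (fun x' => Kval K (g x'))
      (-(η (x, 0)) * Kval K (g x)) x)
    -- `k` : the solution of `k'(x) = −(u(x)⁻¹ η(x,y(x)) u(x)) k(x)`, `k(a) = I`
    (k : ℝ → K) (hk0 : k a = 1)
    (hk : ∀ x ∈ Set.Icc a b, HasDerivWithinAt (fun x' => Kval K (k x'))
      (-(Kval K ((u x)⁻¹) * η (x, y x) * Kval K (u x)) * Kval K (k x)) (Set.Icc a b) x)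
    -- `B(x,y) := g_η(x)⁻¹ (A(x,y) + η̄(x,y)) g_η(x)`
    (B : ℝ × ℝ → Mat D)
    (hB : ∀ p : ℝ × ℝ,
      B p = Kval K ((g p.1)⁻¹) * (A p + (η p - η (p.1, 0))) * Kval K (g p.1))
    -- `v` : parallel translation along `ℓ` with respect to `B dx`
    (v : ℝ → K) (hv0 : v a = 1)
    (hv : ∀ x ∈ Set.Icc a b, HasDerivWithinAt (fun x' => Kval K (v x'))
      (-(B (x, y x)) * Kval K (v x)) (Set.Icc a b) x) :
    -- (i) : `B dx` is the gauge transform `[(A+η)dx]^{g_η}` …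
    ((∀ p : ℝ × ℝ,
        Kval K ((g p.1)⁻¹) * (A p + η p) * Kval K (g p.1)
            + Kval K ((g p.1)⁻¹) * deriv (fun x' => Kval K (g x')) p.1
          = B p) ∧
      -- … and it lies in the complete axial gauge
      (∀ x : ℝ, B (x, 0) = 0)) ∧
    -- (ii) : `v(x) = g_η(x)⁻¹ u(x) k(x) g_η(a)`
    (∀ x ∈ Set.Icc a b,
      Kval K (v x)
        = Kval K ((g x)⁻¹) * Kval K (u x) * Kval K (k x) * Kval K (g a)) := by
  refine ⟨⟨?_, ?_⟩, ?_⟩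
  · intro p
    have hd : deriv (fun x' => Kval K (g x')) p.1 = -(η (p.1, 0)) * Kval K (g p.1) :=
      (hg p.1).deriv
    rw [hd, hB]
    noncomm_ring
  · intro x
    rw [hB]
    simp [hA0]
  · have hl : ContinuousOn (fun x => (x, y x)) (Set.Icc a b) := continuousOn_id.prodMk hy
    have hC : ContinuousOn (fun x => A (x, y x) + η (x, y x)) (Set.Icc a b) :=
      (hA.comp_continuousOn hl).add (hη.comp_continuousOn hl)
    have := lin_ode_unique_aux a b (fun x => A (x, y x) + η (x, y x))
      (fun x => Kval K (g x) * Kval K (v x))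
      (fun x => Kval K (u x) * Kval K (k x) * Kval K (g a)) hC ?_ ?_ ?_
    · intro x hx
      have h := this hx
      simp only at h
      calc Kval K (v x) = (Kval K (g x)⁻¹ * Kval K (g x)) * Kval K (v x) := by
            rw [Kval_inv_mul_aux, one_mul]
        _ = Kval K (g x)⁻¹ * (Kval K (g x) * Kval K (v x)) := by rw [mul_assoc]
        _ = _ := by rw [h]; simp only [mul_assoc]
    · intro x hx
      refine ((hg x).hasDerivWithinAt.mul (hv x hx)).congr_deriv ?_
      rw [hB]
      have e : Kval K (g x) * (-(Kval K (g x)⁻¹ * (A (x, y x) + (η (x, y x) - η (x, 0)))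
          * Kval K (g x)) * Kval K (v x)) = -((Kval K (g x) * Kval K (g x)⁻¹) *
          (A (x, y x) + (η (x, y x) - η (x, 0))) * Kval K (g x) * Kval K (v x)) := by
        noncomm_ring
      simp only
      rw [e, Kval_mul_inv_aux]
      noncomm_ring
    · intro x hx
      refine (((hu x hx).mul (hk x hx)).mul_const (Kval K (g a))).congr_deriv ?_
      have e : Kval K (u x) * (-(Kval K (u x)⁻¹ * η (x, y x) * Kval K (u x)) * Kval K (k x))
          = -((Kval K (u x) * Kval K (u x)⁻¹) * η (x, y x) * Kval K (u x) * Kval K (k x)) := by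
        noncomm_ring
      rw [e, Kval_mul_inv_aux]
      noncomm_ring
    · simp [hu0, hk0, hv0, Kval_one_aux]

end
end

section
/- Let A and η be continuous 𝔨-valued connection one-forms on ℝ^d and ℓ : [0,1] → ℝ^d a C¹ path. For each s ∈ ℝ let u_s : [0,1] → K solve u_s'(t) = −( A_{ℓ(t)}⟨ℓ'(t)⟩ + s·η_{ℓ(t)}⟨ℓ'(t)⟩ ) u_s(t) with u_s(0) = I. Then s ↦ u_s(1) is differentiable at s = 0 and (d/ds)|_{s=0} u_s(1) = −u₀(1) · ∫₀¹ u₀(t)⁻¹ η_{ℓ(t)}⟨ℓ'(t)⟩ u₀(t) dt; i.e. ∂_η[A ↦ //^A(ℓ)] = −//^A(ℓ) ∫₀¹ Ad_{//_t^A(ℓ)⁻¹} η⟨ℓ'(t)⟩ dt. -/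
/-!
Statement 17 (Proposition A.6 of the paper: connection differentiation).

For continuous connection one-forms `A, η` on `ℝ^d` and a `C¹` path `ℓ : [0,1] → ℝ^d`, if
`u_s = //_·^{A + sη}(ℓ)`, then `s ↦ u_s(1)` is differentiable at `s = 0` with
`(d/ds)|₀ u_s(1) = −//₁^A(ℓ) ∫₀¹ Ad_{//_t^A(ℓ)⁻¹} η⟨ℓ'(t)⟩ dt`.
-/

open Matrix

attribute [local instance] Matrix.linftyOpNormedAddCommGroup Matrix.linftyOpNormedRing
  Matrix.linftyOpNormedAlgebra

noncomputable section

theorem par_aux {R : Type*} [NormedRing R] [NormedAlgebra ℝ R] [CompleteSpace R]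
    (a b : ℝ → R) (hb : Continuous b) (u : ℝ → ℝ → Rˣ) (hu0 : ∀ s, u s 0 = 1)
    (hu : ∀ s : ℝ, ∀ t ∈ Set.Icc (0 : ℝ) 1,
      HasDerivWithinAt (fun τ => (u s τ : R))
        (-(a t + s • b t) * (u s t : R)) (Set.Icc 0 1) t) :
    HasDerivAt (fun s => (u s 1 : R))
      (-((u 0 1 : R) * ∫ t in (0 : ℝ)..1, ((u 0 t)⁻¹ : Rˣ) * b t * (u 0 t : R))) 0 := by
  set V : ℝ → R := fun t => (((u 0 t)⁻¹ : Rˣ) : R) with hV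
  set B : ℝ → R := fun t => V t * b t * (u 0 t : R) with hB
  have hVd : ∀ t ∈ Set.Icc (0 : ℝ) 1, HasDerivWithinAt V (V t * a t) (Set.Icc 0 1) t := by
    intro t ht
    have h1 := (hasFDerivAt_ringInverse (𝕜 := ℝ) (u 0 t)).comp_hasDerivWithinAt t (hu 0 t ht)
    have h2 : (Ring.inverse ∘ fun τ => (u 0 τ : R)) = V := by
      funext τ; simp [hV]
    rw [h2] at h1
    refine h1.congr_deriv ?_
    simp [hV, mul_assoc]
  have hVc : ContinuousOn V (Set.Icc 0 1) := fun t ht => (hVd t ht).continuousWithinAt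
  have hUc : ∀ s, ContinuousOn (fun t => (u s t : R)) (Set.Icc 0 1) :=
    fun s t ht => (hu s t ht).continuousWithinAt
  have hBc : ContinuousOn B (Set.Icc 0 1) := (hVc.mul hb.continuousOn).mul (hUc 0)
  obtain ⟨M, hM⟩ := isCompact_Icc.exists_bound_of_continuousOn hBc
  have hM0 : 0 ≤ M := (norm_nonneg _).trans (hM 0 (by simp))
  set w : ℝ → ℝ → R := fun s t => V t * (u s t : R) - 1 with hw
  have hwd : ∀ s, ∀ t ∈ Set.Icc (0 : ℝ) 1,
      HasDerivWithinAt (w s) (-(s • (B t * w s t)) - s • B t) (Set.Icc 0 1) t := by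
    intro s t ht
    have h := ((hVd t ht).mul (hu s t ht)).sub_const 1
    refine HasDerivWithinAt.congr_deriv h ?_
    have : (u 0 t : R) * V t = 1 := by simp [hV]
    have h3 : B t * w s t = V t * b t * (u s t : R) - B t := by
      simp only [hw, hB, mul_sub, mul_one]
      rw [mul_assoc (V t * b t), ← mul_assoc (u 0 t : R), this, one_mul]
    rw [h3]
    simp only [smul_sub, neg_mul, mul_neg, add_mul, mul_add, smul_mul_assoc, mul_smul_comm,
      mul_assoc]
    abel
  have hw0 : ∀ s, w s 0 = 0 := by intro s; simp [hw, hV, hu0]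
  have hici : ∀ {f : ℝ → R} {f' : R} {t : ℝ}, t ∈ Set.Ico (0:ℝ) 1 →
      HasDerivWithinAt f f' (Set.Icc 0 1) t → HasDerivWithinAt f f' (Set.Ici t) t := by
    intro f f' t ht h
    exact h.mono_of_mem_nhdsWithin (Icc_mem_nhdsGE_of_mem ht)
  have hwb : ∀ s, ∀ t ∈ Set.Icc (0 : ℝ) 1, ‖w s t‖ ≤ Real.exp (|s| * M) - 1 := by
    intro s t ht
    have h := norm_le_gronwallBound_of_norm_deriv_right_le (f := w s)
      (f' := fun t => -(s • (B t * w s t)) - s • B t) (δ := 0) (K := |s| * M) (ε := |s| * M)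
      (a := 0) (b := 1) (fun t ht => (hwd s t ht).continuousWithinAt)
      (fun t ht => hici ht (hwd s t (Set.Ico_subset_Icc_self ht))) (by simp [hw0])
      (fun t ht => by
        have hm := hM t (Set.Ico_subset_Icc_self ht)
        refine (norm_sub_le _ _).trans ?_
        rw [norm_neg, norm_smul, norm_smul, Real.norm_eq_abs]
        have := norm_mul_le (B t) (w s t)
        have h5 : ‖B t * w s t‖ ≤ M * ‖w s t‖ := this.trans (by gcongr)
        rw [mul_assoc |s| M]
        gcongr) t ht
    refine h.trans ?_
    have hk : 0 ≤ |s| * M := by positivity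
    have hle : |s| * M * (t - 0) ≤ |s| * M := by
      rw [sub_zero]; exact mul_le_of_le_one_right hk ht.2
    by_cases hz : |s| * M = 0
    · rw [hz, gronwallBound_K0]; simp
    · rw [gronwallBound_of_K_ne_0 hz, div_self hz]
      simpa using hle
  have hint : ∀ t ∈ Set.Icc (0 : ℝ) 1,
      HasDerivWithinAt (fun t => ∫ x in (0:ℝ)..t, B x) (B t) (Set.Icc 0 1) t := by
    intro t ht
    have : Fact (t ∈ Set.Icc (0:ℝ) 1) := ⟨ht⟩
    refine intervalIntegral.integral_hasDerivWithinAt_right ?_ (s := Set.Icc 0 1) (t := Set.Icc 0 1)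
      ?_ (hBc t ht)
    · apply ContinuousOn.intervalIntegrable
      rw [Set.uIcc_of_le ht.1]
      exact hBc.mono (Set.Icc_subset_Icc_right ht.2)
    · exact hBc.stronglyMeasurableAtFilter_nhdsWithin measurableSet_Icc t
  have hkey : ∀ s, ‖w s 1 + s • ∫ x in (0:ℝ)..1, B x‖ ≤ |s| * (M * (Real.exp (|s| * M) - 1)) := by
    intro s
    have h := norm_image_sub_le_of_norm_deriv_le_segment' (a := 0) (b := 1)
      (f := fun t => w s t + s • ∫ x in (0:ℝ)..t, B x)
      (f' := fun t => -(s • (B t * w s t)) - s • B t + s • B t)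
      (C := |s| * (M * (Real.exp (|s| * M) - 1)))
      (fun t ht => (hwd s t ht).add ((hint t ht).const_smul s))
      (fun t ht => by
        have ht' := Set.Ico_subset_Icc_self ht
        rw [sub_add_cancel, norm_neg, norm_smul, Real.norm_eq_abs]
        have h5 := hM t ht'
        have h6 := hwb s t ht'
        have := norm_mul_le (B t) (w s t)
        have h7 : ‖B t * w s t‖ ≤ M * (Real.exp (|s| * M) - 1) := this.trans (by gcongr)
        gcongr) 1 (by simp)
    simpa [hw0] using h
  have hwder : HasDerivAt (fun s => w s 1) (-∫ x in (0:ℝ)..1, B x) 0 := by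
    rw [hasDerivAt_iff_isLittleO]
    have hz : w 0 1 = 0 := by simp [hw, hV]
    have hlim : Filter.Tendsto (fun s : ℝ => M * (Real.exp (|s| * M) - 1)) (nhds 0) (nhds 0) := by
      have : Continuous (fun s : ℝ => M * (Real.exp (|s| * M) - 1)) := by fun_prop
      simpa using this.tendsto 0
    rw [Asymptotics.isLittleO_iff]
    intro c hc
    filter_upwards [hlim.eventually_lt_const hc] with s hs
    simp only [hz, sub_zero, smul_neg, sub_neg_eq_add]
    refine (hkey s).trans ?_
    rw [Real.norm_eq_abs, mul_comm]
    gcongr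
  have hfin := (hwder.const_mul (u 0 1 : R)).add_const (u 0 1 : R)
  have e1 : (fun s => (u 0 1 : R) * w s 1 + (u 0 1 : R)) = fun s => (u s 1 : R) := by
    funext s
    simp [hw, hV, mul_sub]
  rw [e1] at hfin
  refine hfin.congr_deriv ?_
  rw [mul_neg]

theorem stmt17 {D d : ℕ} (K : Subgroup (Mat D)ˣ)
    (A η : EuclideanSpace ℝ (Fin d) → EuclideanSpace ℝ (Fin d) → Mat D)
    (hA : Continuous (Function.uncurry A)) (hη : Continuous (Function.uncurry η))
    (hAlin : ∀ x, IsLinearMap ℝ (A x)) (hηlin : ∀ x, IsLinearMap ℝ (η x))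
    (ℓ : ℝ → EuclideanSpace ℝ (Fin d)) (hℓ : ContDiff ℝ 1 ℓ)
    -- `u s = //_·^{A + sη}(ℓ)`
    (u : ℝ → ℝ → K) (hu0 : ∀ s, u s 0 = 1)
    (hu : ∀ s : ℝ, ∀ t ∈ Set.Icc (0 : ℝ) 1,
      HasDerivWithinAt (fun τ => Kval K (u s τ))
        (-(A (ℓ t) (deriv ℓ t) + s • η (ℓ t) (deriv ℓ t)) * Kval K (u s t))
        (Set.Icc 0 1) t) :
    HasDerivAt (fun s => Kval K (u s 1))
      (-(Kval K (u 0 1)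
          * ∫ t in (0 : ℝ)..1,
              Kval K ((u 0 t)⁻¹) * η (ℓ t) (deriv ℓ t) * Kval K (u 0 t))) 0 := by
  have hb : Continuous fun t => η (ℓ t) (deriv ℓ t) :=
    hη.comp (hℓ.continuous.prodMk (hℓ.continuous_deriv le_rfl))
  exact par_aux (fun t => A (ℓ t) (deriv ℓ t)) (fun t => η (ℓ t) (deriv ℓ t)) hb
    (fun s t => (u s t : (Mat D)ˣ)) (fun s => by rw [hu0]; rfl) hu

end
end

section
/- Let A be a C¹ 𝔨-valued connection one-form on ℝ^d and let Σ : I × [0,1] → ℝ^d be a C² map on an open interval I such that Σ(s,0) = p is independent of s. For each s let u(s,·) : [0,1] → K solve ∂_t u(s,t) = −A_{Σ(s,t)}⟨∂_tΣ(s,t)⟩ u(s,t) with u(s,0) = I. Then u is differentiable in s and for all (s,t) the covariant s-derivative satisfies ∂_s u(s,t) + A_{Σ(s,t)}⟨∂_sΣ(s,t)⟩ u(s,t) = u(s,t) · ∫₀^t u(s,τ)⁻¹ F^A_{Σ(s,τ)}( ∂_tΣ(s,τ), ∂_sΣ(s,τ) ) u(s,τ) dτ. If in addition Σ(s,1) =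 q is independent of s, then ∂_s u(s,1) = u(s,1) · ∫₀¹ u(s,τ)⁻¹ F^A_{Σ(s,τ)}( ∂_tΣ(s,τ), ∂_sΣ(s,τ) ) u(s,τ) dτ. -/
/-!
Statement 18 (Proposition A.7 of the paper: path differentiation).

For a `C¹` connection one-form `A` on `ℝ^d` and a `C²` family of paths `Σ(s,t)` with
`Σ(s,0) = p` fixed, the parallel translations `u(s,t) = //_t^A(Σ(s,·))` satisfy
`∂_s u(s,t) + A⟨∂_sΣ(s,t)⟩ u(s,t)
  = u(s,t) ∫₀^t Ad_{u(s,τ)⁻¹} F^A(∂_tΣ(s,τ), ∂_sΣ(s,τ)) dτ`,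
and if moreover `Σ(s,1) = q` is fixed, then
`∂_s u(s,1) = u(s,1) ∫₀¹ Ad_{u(s,τ)⁻¹} F^A(∂_tΣ(s,τ), ∂_sΣ(s,τ)) dτ`.
-/

open Matrix

attribute [local instance] Matrix.linftyOpNormedAddCommGroup Matrix.linftyOpNormedRing
  Matrix.linftyOpNormedAlgebra

noncomputable section

/-- The curvature two-form
`F^B_x(v,w) = (∂_v B)⟨w⟩(x) − (∂_w B)⟨v⟩(x) + [B_x⟨v⟩, B_x⟨w⟩]`. -/
def curvBil {d D : ℕ}
    (B : EuclideanSpace ℝ (Fin d) → EuclideanSpace ℝ (Fin d) → Mat D)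
    (x v w : EuclideanSpace ℝ (Fin d)) : Mat D :=
  fderiv ℝ (fun y => B y w) x v - fderiv ℝ (fun y => B y v) x w
    + (B x v * B x w - B x w * B x v)

section aux
open Set Filter Topology MeasureTheory Interval
variable {R : Type*} [NormedRing R] [NormedAlgebra ℝ R] [CompleteSpace R]

theorem aux_inv {V : ℝ → Rˣ} {x : R} {S : Set ℝ} {t : ℝ}
    (h : HasDerivWithinAt (fun τ => (V τ : R)) x S t) :
    HasDerivWithinAt (fun τ => (((V τ)⁻¹ : Rˣ) : R))
      (-(((V t)⁻¹ : Rˣ) * x * ((V t)⁻¹ : Rˣ))) S t := by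
  have h1 := (hasFDerivAt_ringInverse (𝕜 := ℝ) (V t)).comp_hasDerivWithinAt t h
  have e : (Ring.inverse ∘ fun τ => (V τ : R)) = fun τ => (((V τ)⁻¹ : Rˣ) : R) := by
    funext τ; simp
  rw [e] at h1
  simpa using h1

theorem aux_dirac {B B' : ℝ → ℝ → R} (hB : Continuous (Function.uncurry B))
    (hB' : Continuous (Function.uncurry B'))
    (hBd : ∀ s τ, HasDerivAt (fun s => B s τ) (B' s τ) s)
    (V : ℝ → ℝ → Rˣ) (hV0 : ∀ s, V s 0 = 1)
    (hV : ∀ s : ℝ, ∀ t ∈ Icc (0 : ℝ) 1,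
      HasDerivWithinAt (fun τ => (V s τ : R)) (-(B s t) * V s t) (Icc 0 1) t)
    (s0 t : ℝ) (ht : t ∈ Icc (0 : ℝ) 1) :
    HasDerivAt (fun s => (V s t : R))
      (-((V s0 t : R) * ∫ τ in (0 : ℝ)..t, ((V s0 τ)⁻¹ : Rˣ) * B' s0 τ * V s0 τ)) s0 := by
  have hVc : ∀ s, ContinuousOn (fun τ => (V s τ : R)) (Icc 0 1) := fun s τ hτ =>
    (hV s τ hτ).continuousWithinAt
  have hWd : ∀ s : ℝ, ∀ t ∈ Icc (0 : ℝ) 1,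
      HasDerivWithinAt (fun τ => (((V s τ)⁻¹ : Rˣ) : R)) (((V s t)⁻¹ : Rˣ) * B s t)
        (Icc 0 1) t := by
    intro s t ht
    have := aux_inv (hV s t ht)
    convert this using 1
    simp [mul_assoc]
  have hWc : ∀ s, ContinuousOn (fun τ => (((V s τ)⁻¹ : Rˣ) : R)) (Icc 0 1) := fun s τ hτ =>
    (hWd s τ hτ).continuousWithinAt
  have hBt : ∀ s, Continuous (B s) := fun s => hB.comp (Continuous.prodMk_right s)
  have hBt' : ∀ s, Continuous (B' s) := fun s => hB'.comp (Continuous.prodMk_right s)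
  -- Duhamel
  have duh : ∀ s, ∀ t ∈ Icc (0 : ℝ) 1, (V s t : R) - V s0 t =
      V s0 t * ∫ τ in (0 : ℝ)..t, ((V s0 τ)⁻¹ : Rˣ) * (B s0 τ - B s τ) * V s τ := by
    intro s t ht
    have hsub : Icc 0 t ⊆ Icc (0 : ℝ) 1 := Icc_subset_Icc_right ht.2
    have := intervalIntegral.integral_eq_sub_of_hasDerivAt_of_le (a := 0) (b := t)
      (f := fun τ => ((V s0 τ)⁻¹ : Rˣ) * (V s τ : R))
      (f' := fun τ => ((V s0 τ)⁻¹ : Rˣ) * (B s0 τ - B s τ) * V s τ) ht.1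
      (((hWc s0).mul (hVc s)).mono hsub) ?_ ?_
    · rw [this]
      simp [hV0, mul_sub]
    · intro x hx
      have hx' : x ∈ Icc (0 : ℝ) 1 := ⟨hx.1.le, hx.2.le.trans ht.2⟩
      have hn : Icc (0 : ℝ) 1 ∈ 𝓝 x := Icc_mem_nhds hx.1 (hx.2.trans_le ht.2)
      convert! ((hWd s0 x hx').mul (hV s x hx')).hasDerivAt hn using 1
      noncomm_ring
    · apply ContinuousOn.intervalIntegrable
      rw [uIcc_of_le ht.1]
      exact (((hWc s0).mul ((hBt s0).sub (hBt s)).continuousOn).mul (hVc s)).mono hsub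
  -- bounds
  have hcomp : IsCompact (Icc (s0 - 1) (s0 + 1) ×ˢ Icc (0 : ℝ) 1) :=
    isCompact_Icc.prod isCompact_Icc
  obtain ⟨M, hM⟩ := hcomp.exists_bound_of_continuousOn hB.continuousOn
  obtain ⟨L, hL⟩ := hcomp.exists_bound_of_continuousOn hB'.continuousOn
  obtain ⟨P, hP⟩ := isCompact_Icc.exists_bound_of_continuousOn (hWc s0)
  have hs0 : s0 ∈ Icc (s0 - 1) (s0 + 1) := ⟨by linarith, by linarith⟩
  have h0 : (0 : ℝ) ∈ Icc (0 : ℝ) 1 := ⟨le_rfl, zero_le_one⟩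
  have hM0 : 0 ≤ M := (norm_nonneg _).trans (hM (s0, 0) ⟨hs0, h0⟩)
  have hL0 : 0 ≤ L := (norm_nonneg _).trans (hL (s0, 0) ⟨hs0, h0⟩)
  have hP0 : 0 ≤ P := (norm_nonneg _).trans (hP 0 h0)
  set Q : ℝ := ‖(1 : R)‖ * Real.exp M with hQ
  have hQ0 : 0 ≤ Q := by positivity
  have hVb : ∀ s ∈ Icc (s0 - 1) (s0 + 1), ∀ τ ∈ Icc (0 : ℝ) 1, ‖(V s τ : R)‖ ≤ Q := by
    intro s hs τ hτ
    have := norm_le_gronwallBound_of_norm_deriv_right_le (δ := ‖(1 : R)‖) (K := M) (ε := 0)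
      (hVc s) (f' := fun τ => -(B s τ) * V s τ) ?_ (by simp [hV0]) ?_ τ hτ
    · refine this.trans ?_
      rw [gronwallBound_ε0, hQ]
      gcongr
      simpa using mul_le_of_le_one_right hM0 hτ.2
    · intro x hx
      exact (hV s x ⟨hx.1, hx.2.le⟩).mono_of_mem_nhdsWithin
        (mem_of_superset (Icc_mem_nhdsGE hx.2) (Icc_subset_Icc_left hx.1))
    · intro x hx
      rw [add_zero]
      refine (norm_mul_le _ _).trans ?_
      gcongr
      rw [norm_neg]
      exact hM (s, x) ⟨hs, ⟨hx.1, hx.2.le⟩⟩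
  have hBl : ∀ s ∈ Icc (s0 - 1) (s0 + 1), ∀ τ ∈ Icc (0 : ℝ) 1,
      ‖B s0 τ - B s τ‖ ≤ L * |s - s0| := by
    intro s hs τ hτ
    have := (convex_Icc (s0 - 1) (s0 + 1)).norm_image_sub_le_of_norm_hasDerivWithin_le
      (f := fun s => B s τ) (f' := fun s => B' s τ) (C := L)
      (fun x _ => (hBd x τ).hasDerivWithinAt) (fun x hx => hL (x, τ) ⟨hx, hτ⟩) hs hs0
    rwa [Real.norm_eq_abs, abs_sub_comm] at this
  have hint : ∀ s ∈ Icc (s0 - 1) (s0 + 1), ∀ τ ∈ Icc (0 : ℝ) 1,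
      ‖((V s0 τ)⁻¹ : Rˣ) * (B s0 τ - B s τ) * V s τ‖ ≤ P * (L * |s - s0|) * Q := by
    intro s hs τ hτ
    refine (norm_mul_le _ _).trans ?_
    gcongr
    · refine (norm_mul_le _ _).trans ?_
      gcongr
      · exact hP τ hτ
      · exact hBl s hs τ hτ
    · exact hVb s hs τ hτ
  have hnear : ∀ᶠ s in 𝓝 s0, s ∈ Icc (s0 - 1) (s0 + 1) :=
    Icc_mem_nhds (by linarith) (by linarith)
  have hVl : ∀ τ ∈ Icc (0 : ℝ) 1, Tendsto (fun s => (V s τ : R)) (𝓝 s0) (𝓝 (V s0 τ)) := by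
    intro τ hτ
    rw [tendsto_iff_norm_sub_tendsto_zero]
    have hlim : Tendsto (fun s => Q * (P * (L * |s - s0|) * Q * |τ - 0|)) (𝓝 s0) (𝓝 0) := by
      have : Continuous (fun s => Q * (P * (L * |s - s0|) * Q * |τ - 0|)) := by fun_prop
      simpa using this.tendsto s0
    refine tendsto_of_tendsto_of_tendsto_of_le_of_le' tendsto_const_nhds hlim
      (Eventually.of_forall fun _ => norm_nonneg _) ?_
    filter_upwards [hnear] with s hs
    rw [duh s τ hτ]
    refine (norm_mul_le _ _).trans ?_
    gcongr
    · exact hVb s0 hs0 τ hτ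
    · refine intervalIntegral.norm_integral_le_of_norm_le_const fun x hx => ?_
      rw [uIoc_of_le hτ.1] at hx
      exact hint s hs x ⟨hx.1.le, hx.2.trans hτ.2⟩
  -- dominated convergence
  rw [hasDerivAt_iff_tendsto_slope]
  have hmain : Tendsto (fun s => ∫ τ in (0 : ℝ)..t,
      (s - s0)⁻¹ • ((((V s0 τ)⁻¹ : Rˣ) : R) * (B s0 τ - B s τ) * V s τ)) (𝓝[≠] s0)
      (𝓝 (∫ τ in (0 : ℝ)..t, -((((V s0 τ)⁻¹ : Rˣ) : R) * B' s0 τ * V s0 τ))) := by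
    have hsub : Ι 0 t ⊆ Icc (0 : ℝ) 1 := by
      rw [uIoc_of_le ht.1]
      exact fun x hx => ⟨hx.1.le, hx.2.trans ht.2⟩
    refine intervalIntegral.tendsto_integral_filter_of_dominated_convergence
      (fun _ => P * L * Q) ?_ ?_ intervalIntegrable_const ?_
    · refine Eventually.of_forall fun s => ?_
      refine ContinuousOn.aestronglyMeasurable ?_ measurableSet_uIoc
      exact ((((hWc s0).mul ((hBt s0).sub (hBt s)).continuousOn).mul (hVc s)).mono
        hsub).const_smul _
    · filter_upwards [hnear.filter_mono nhdsWithin_le_nhds, self_mem_nhdsWithin] with s hs hne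
      refine Eventually.of_forall fun τ hτ => ?_
      have hpos : 0 < |s - s0| := abs_pos.2 (sub_ne_zero.2 hne)
      rw [norm_smul, norm_inv, Real.norm_eq_abs, inv_mul_le_iff₀ hpos]
      refine (hint s hs τ (hsub hτ)).trans (le_of_eq (by ring))
    · refine Eventually.of_forall fun τ hτ => ?_
      have h1 := hasDerivAt_iff_tendsto_slope.1 (hBd s0 τ)
      have h2 := (hVl τ (hsub hτ)).mono_left (nhdsWithin_le_nhds (s := {s0}ᶜ))
      have h3 := ((tendsto_const_nhds (x := (((V s0 τ)⁻¹ : Rˣ) : R))).mul h1).mul h2 |>.neg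
      refine h3.congr fun s => ?_
      simp only [slope_def_module]
      rw [mul_smul_comm, smul_mul_assoc, ← smul_neg]
      congr 1
      noncomm_ring
  have h4 := hmain.const_mul (V s0 t : R)
  rw [intervalIntegral.integral_neg, mul_neg] at h4
  refine h4.congr fun s => ?_
  rw [slope_def_module, duh s t ht, intervalIntegral.integral_smul, mul_smul_comm]

variable {E : Type*} [NormedAddCommGroup E] [NormedSpace ℝ E]

theorem aux_fderiv {A : E → E → R} (hA : ContDiff ℝ 1 (Function.uncurry A))
    (hAlin : ∀ x, IsLinearMap ℝ (A x)) (x v ξ η : E) :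
    fderiv ℝ (Function.uncurry A) (x, v) (ξ, η) = fderiv ℝ (fun y => A y v) x ξ + A x η := by
  have hd : HasFDerivAt (Function.uncurry A) (fderiv ℝ (Function.uncurry A) (x, v)) (x, v) :=
    (hA.differentiable (by norm_num) _).hasFDerivAt
  have h1 : HasFDerivAt (fun y => A y v)
      ((fderiv ℝ (Function.uncurry A) (x, v)).comp (ContinuousLinearMap.inl ℝ E E)) x :=
    HasFDerivAt.comp x (g := Function.uncurry A) (f := fun e => (e, v)) hd
      (hasFDerivAt_prodMk_left x v)
  have h2 : HasDerivAt (fun r : ℝ => A x (v + r • η))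
      (fderiv ℝ (Function.uncurry A) (x, v) (0, η)) 0 := by
    have hl : HasDerivAt (fun r : ℝ => (x, v + r • η)) ((0 : E), η) 0 := by
      refine (hasDerivAt_const _ _).prodMk ?_
      simpa using ((hasDerivAt_id (0 : ℝ)).smul_const η).const_add v
    have hd' : HasFDerivAt (Function.uncurry A) (fderiv ℝ (Function.uncurry A) (x, v))
      ((fun r : ℝ => (x, v + r • η)) 0) := by simpa using hd
    exact hd'.comp_hasDerivAt 0 hl
  have h3 : HasDerivAt (fun r : ℝ => A x (v + r • η)) (A x η) 0 := by
    have : (fun r : ℝ => A x (v + r • η)) = fun r => A x v + r • A x η := by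
      funext r
      rw [(hAlin x).map_add, (hAlin x).map_smul]
    rw [this]
    simpa using ((hasDerivAt_id (0 : ℝ)).smul_const (A x η)).const_add (A x v)
  rw [h1.fderiv, ← h2.unique h3]
  have : ((ξ, η) : E × E) = (ξ, 0) + (0, η) := by simp
  rw [this, map_add]
  simp

theorem aux_core (A : E → E → R) (hA : ContDiff ℝ 1 (Function.uncurry A))
    (hAlin : ∀ x, IsLinearMap ℝ (A x)) (Sg : ℝ → ℝ → E)
    (hSg : ContDiff ℝ 2 (Function.uncurry Sg)) (p : E) (hSg0 : ∀ s, Sg s 0 = p)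
    (V : ℝ → ℝ → Rˣ) (hV0 : ∀ s, V s 0 = 1)
    (hV : ∀ s : ℝ, ∀ t ∈ Icc (0 : ℝ) 1,
      HasDerivWithinAt (fun τ => (V s τ : R))
        (-(A (Sg s t) (deriv (fun τ => Sg s τ) t)) * V s t) (Icc 0 1) t)
    (F : E → E → E → R)
    (hF : ∀ x v w, F x v w = fderiv ℝ (fun y => A y w) x v - fderiv ℝ (fun y => A y v) x w
      + (A x v * A x w - A x w * A x v))
    (s t : ℝ) (ht : t ∈ Icc (0 : ℝ) 1) :
    HasDerivAt (fun s => (V s t : R))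
      (-(A (Sg s t) (deriv (fun σ' => Sg σ' t) s)) * V s t
        + V s t * ∫ τ in (0 : ℝ)..t, ((V s τ)⁻¹ : Rˣ)
            * F (Sg s τ) (deriv (fun τ' => Sg s τ') τ) (deriv (fun σ' => Sg σ' τ) s)
            * V s τ) s := by
  set G : ℝ × ℝ → E := Function.uncurry Sg with hG
  have hGd : ∀ z, HasFDerivAt G (fderiv ℝ G z) z := fun z =>
    (hSg.differentiable (by norm_num) z).hasFDerivAt
  have hDG : ContDiff ℝ 1 (fderiv ℝ G) := hSg.fderiv_right (by norm_num)
  have hl1 : ∀ s t : ℝ, HasDerivAt (fun σ : ℝ => (σ, t)) ((1 : ℝ), (0 : ℝ)) s := fun s t =>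
    (hasDerivAt_id s).prodMk (hasDerivAt_const s t)
  have hl2 : ∀ s t : ℝ, HasDerivAt (fun τ : ℝ => (s, τ)) ((0 : ℝ), (1 : ℝ)) t := fun s t =>
    (hasDerivAt_const t s).prodMk (hasDerivAt_id t)
  have eS : ∀ s t, deriv (fun σ' => Sg σ' t) s = fderiv ℝ G (s, t) (1, 0) := fun s t =>
    (HasFDerivAt.comp_hasDerivAt (l := G) (f := fun σ : ℝ => (σ, t)) s (hGd (s, t)) (hl1 s t)).deriv
  have eT : ∀ s t, deriv (fun τ' => Sg s τ') t = fderiv ℝ G (s, t) (0, 1) := fun s t =>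
    ((hGd (s, t)).comp_hasDerivAt t (hl2 s t)).deriv
  -- general fact about `A (G z) (fderiv G z w)`
  have hgen : ∀ w z, HasFDerivAt (fun z => A (G z) (fderiv ℝ G z w))
      ((fderiv ℝ (Function.uncurry A) (G z, fderiv ℝ G z w)).comp
        ((fderiv ℝ G z).prod ((fderiv ℝ (fderiv ℝ G) z).flip w))) z := by
    intro w z
    have h1 : HasFDerivAt (fun z => fderiv ℝ G z w) ((fderiv ℝ (fderiv ℝ G) z).flip w) z := by
      have := ((hDG.differentiable (by norm_num) z).hasFDerivAt).clm_apply (hasFDerivAt_const w z)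
      convert! this using 1
      simp
    exact HasFDerivAt.comp z (g := Function.uncurry A)
      (f := fun z => (G z, fderiv ℝ G z w))
      (hA.differentiable (by norm_num) (G z, fderiv ℝ G z w)).hasFDerivAt ((hGd z).prodMk h1)
  have hval : ∀ w z v, ((fderiv ℝ (Function.uncurry A) (G z, fderiv ℝ G z w)).comp
        ((fderiv ℝ G z).prod ((fderiv ℝ (fderiv ℝ G) z).flip w))) v =
      fderiv ℝ (fun y => A y (fderiv ℝ G z w)) (G z) (fderiv ℝ G z v)
        + A (G z) (fderiv ℝ (fderiv ℝ G) z v w) := by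
    intro w z v
    rw [← aux_fderiv hA hAlin]
    rfl
  have hcd : ∀ w, ContDiff ℝ 1 (fun z => A (G z) (fderiv ℝ G z w)) := fun w =>
    hA.comp ((hSg.of_le (by norm_num)).prodMk (hDG.clm_apply contDiff_const))
  have hcont' : ∀ w v, Continuous fun z => fderiv ℝ (fun z => A (G z) (fderiv ℝ G z w)) z v :=
    fun w v => ((hcd w).continuous_fderiv (by norm_num)).clm_apply continuous_const
  set b : ℝ × ℝ → R := fun z => A (G z) (fderiv ℝ G z (0, 1)) with hb
  set c : ℝ × ℝ → R := fun z => A (G z) (fderiv ℝ G z (1, 0)) with hc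
  have hV' : ∀ s : ℝ, ∀ t ∈ Icc (0 : ℝ) 1,
      HasDerivWithinAt (fun τ => (V s τ : R)) (-(b (s, t)) * V s t) (Icc 0 1) t := by
    intro s t ht
    have := hV s t ht
    rwa [eT] at this
  have hdir := aux_dirac (B := fun s t => b (s, t)) (B' := fun s t => fderiv ℝ b (s, t) (1, 0))
    (hcd _).continuous (hcont' _ _)
    (fun s τ => HasFDerivAt.comp_hasDerivAt (l := b) (f := fun σ : ℝ => (σ, τ)) s
      ((hcd (0, 1)).differentiable (by norm_num) (s, τ)).hasFDerivAt (hl1 s τ)) V hV0 hV' s t ht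
  have hFeq : ∀ τ, F (Sg s τ) (deriv (fun τ' => Sg s τ') τ) (deriv (fun σ' => Sg σ' τ) s) =
      fderiv ℝ c (s, τ) (0, 1) - fderiv ℝ b (s, τ) (1, 0)
        + (b (s, τ) * c (s, τ) - c (s, τ) * b (s, τ)) := by
    intro τ
    have hsym : fderiv ℝ (fderiv ℝ G) (s, τ) (0, 1) (1, 0)
        = fderiv ℝ (fderiv ℝ G) (s, τ) (1, 0) (0, 1) :=
      (hSg.contDiffAt.isSymmSndFDerivAt (by simp)) _ _
    rw [hF, eS, eT, (hgen (1, 0) (s, τ)).fderiv, (hgen (0, 1) (s, τ)).fderiv, hval, hval, hsym]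
    simp only [hb, hc, hG, Function.uncurry]
    abel
  simp only [hFeq]
  convert hdir using 1
  have hsub : Icc 0 t ⊆ Icc (0 : ℝ) 1 := Icc_subset_Icc_right ht.2
  have hVc : ContinuousOn (fun τ => (V s τ : R)) (Icc 0 t) := fun τ hτ =>
    ((hV' s τ (hsub hτ)).continuousWithinAt).mono hsub
  have hWd : ∀ t ∈ Icc (0 : ℝ) 1,
      HasDerivWithinAt (fun τ => (((V s τ)⁻¹ : Rˣ) : R)) (((V s t)⁻¹ : Rˣ) * b (s, t))
        (Icc 0 1) t := by
    intro t ht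
    have := aux_inv (hV' s t ht)
    convert this using 1
    simp [mul_assoc]
  have hWc : ContinuousOn (fun τ => (((V s τ)⁻¹ : Rˣ) : R)) (Icc 0 t) := fun τ hτ =>
    ((hWd τ (hsub hτ)).continuousWithinAt).mono hsub
  have hline : Continuous fun τ : ℝ => (s, τ) := Continuous.prodMk_right s
  have hbc : Continuous fun τ => b (s, τ) := (hcd _).continuous.comp hline
  have hcc : Continuous fun τ => c (s, τ) := (hcd _).continuous.comp hline
  have hb'c : Continuous fun τ => fderiv ℝ b (s, τ) (1, 0) := (hcont' _ _).comp hline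
  have hc'c : Continuous fun τ => fderiv ℝ c (s, τ) (0, 1) := (hcont' _ _).comp hline
  have hI : ∀ X : ℝ → R, Continuous X → IntervalIntegrable
      (fun τ => (((V s τ)⁻¹ : Rˣ) : R) * X τ * V s τ) volume 0 t := by
    intro X hX
    apply ContinuousOn.intervalIntegrable
    rw [uIcc_of_le ht.1]
    exact (hWc.mul hX.continuousOn).mul hVc
  have hc0 : c (s, 0) = 0 := by
    have : fderiv ℝ G (s, 0) (1, 0) = 0 := by
      rw [← eS]
      simp [hSg0]
    simp only [hc, this]
    exact (hAlin _).map_zero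
  have ftc := intervalIntegral.integral_eq_sub_of_hasDerivAt_of_le (a := 0) (b := t)
      (f := fun τ => (((V s τ)⁻¹ : Rˣ) : R) * c (s, τ) * (V s τ : R))
      (f' := fun τ => (((V s τ)⁻¹ : Rˣ) : R) * (fderiv ℝ c (s, τ) (0, 1)
        + (b (s, τ) * c (s, τ) - c (s, τ) * b (s, τ))) * V s τ) ht.1
      ((hWc.mul hcc.continuousOn).mul hVc) ?_
      (hI _ (hc'c.add ((hbc.mul hcc).sub (hcc.mul hbc))))
  · have hsplit : (∫ τ in (0 : ℝ)..t, (((V s τ)⁻¹ : Rˣ) : R) * (fderiv ℝ c (s, τ) (0, 1)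
          - fderiv ℝ b (s, τ) (1, 0)
          + (b (s, τ) * c (s, τ) - c (s, τ) * b (s, τ))) * V s τ) =
        (∫ τ in (0 : ℝ)..t, (((V s τ)⁻¹ : Rˣ) : R) * (fderiv ℝ c (s, τ) (0, 1)
          + (b (s, τ) * c (s, τ) - c (s, τ) * b (s, τ))) * V s τ)
        - ∫ τ in (0 : ℝ)..t, (((V s τ)⁻¹ : Rˣ) : R) * fderiv ℝ b (s, τ) (1, 0) * V s τ := by
      rw [← intervalIntegral.integral_sub
        (hI (fun τ => fderiv ℝ c (s, τ) (0, 1)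
          + (b (s, τ) * c (s, τ) - c (s, τ) * b (s, τ)))
          (hc'c.add ((hbc.mul hcc).sub (hcc.mul hbc)))) (hI _ hb'c)]
      congr 1
      funext τ
      noncomm_ring
    rw [hsplit, ftc, eS, hc0]
    change -(c (s, t)) * _ + _ = _
    simp [mul_sub, ← mul_assoc]
    abel
  · intro x hx
    have hx' : x ∈ Icc (0 : ℝ) 1 := ⟨hx.1.le, hx.2.le.trans ht.2⟩
    have hn : Icc (0 : ℝ) 1 ∈ 𝓝 x := Icc_mem_nhds hx.1 (hx.2.trans_le ht.2)
    have hcx : HasDerivWithinAt (fun τ => c (s, τ)) (fderiv ℝ c (s, x) (0, 1)) (Icc 0 1) x :=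
      ((((hcd (1, 0)).differentiable (by norm_num) (s, x)).hasFDerivAt).comp_hasDerivAt x
        (hl2 s x)).hasDerivWithinAt
    convert! (((hWd x hx').mul hcx).mul (hV' s x hx')).hasDerivAt hn using 1
    simp only [Pi.mul_apply]
    noncomm_ring

end aux

theorem stmt18 {D d : ℕ} (K : Subgroup (Mat D)ˣ)
    (A : EuclideanSpace ℝ (Fin d) → EuclideanSpace ℝ (Fin d) → Mat D)
    (hA : ContDiff ℝ 1 (Function.uncurry A)) (hAlin : ∀ x, IsLinearMap ℝ (A x))
    -- the `C²` family of paths `Σ`, with fixed initial point `p`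
    (Sg : ℝ → ℝ → EuclideanSpace ℝ (Fin d))
    (hSg : ContDiff ℝ 2 (Function.uncurry Sg))
    (p : EuclideanSpace ℝ (Fin d)) (hSg0 : ∀ s, Sg s 0 = p)
    -- `u s = //_·^A(Σ(s,·))`
    (u : ℝ → ℝ → K) (hu0 : ∀ s, u s 0 = 1)
    (hu : ∀ s : ℝ, ∀ t ∈ Set.Icc (0 : ℝ) 1,
      HasDerivWithinAt (fun τ => Kval K (u s τ))
        (-(A (Sg s t) (deriv (fun τ => Sg s τ) t)) * Kval K (u s t))
        (Set.Icc 0 1) t) :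
    -- main conclusion : the covariant `s`-derivative of `u(s,t)`
    (∀ s : ℝ, ∀ t ∈ Set.Icc (0 : ℝ) 1,
      HasDerivAt (fun σ' => Kval K (u σ' t))
        (-(A (Sg s t) (deriv (fun σ' => Sg σ' t) s)) * Kval K (u s t)
          + Kval K (u s t)
              * ∫ τ in (0 : ℝ)..t,
                  Kval K ((u s τ)⁻¹)
                    * curvBil A (Sg s τ) (deriv (fun τ' => Sg s τ') τ)
                        (deriv (fun σ' => Sg σ' τ) s)
                    * Kval K (u s τ)) s) ∧
    -- and if additionally the endpoint `Σ(s,1) = q` is fixed :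
    (∀ q : EuclideanSpace ℝ (Fin d), (∀ s, Sg s 1 = q) →
      ∀ s : ℝ,
        HasDerivAt (fun σ' => Kval K (u σ' 1))
          (Kval K (u s 1)
            * ∫ τ in (0 : ℝ)..1,
                Kval K ((u s τ)⁻¹)
                  * curvBil A (Sg s τ) (deriv (fun τ' => Sg s τ') τ)
                      (deriv (fun σ' => Sg σ' τ) s)
                  * Kval K (u s τ)) s) := by
  have key := fun s t ht => aux_core A hA hAlin Sg hSg p hSg0
    (fun s t => ((u s t : K) : (Mat D)ˣ)) (fun s => by simp [hu0]) hu
    (curvBil A) (fun _ _ _ => rfl) s t ht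
  refine ⟨fun s t ht => key s t ht, fun q hq s => ?_⟩
  have h := key s 1 ⟨zero_le_one, le_rfl⟩
  have e : deriv (fun σ' => Sg σ' 1) s = 0 := by simp [hq]
  rw [e, (hAlin _).map_zero, neg_zero, zero_mul, zero_add] at h
  exact h
end
end
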